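/- Let 2 ≤ b < c be integers with gcd(b,c) > 1. Then no real number is a Trott number in both base b and base c; that is, T_b ∩ T_c = ∅. -/

import Mathlib

open Filter Topology

/-- Number of digits of `a` in base `b`. -/
def digLen (b a : ℕ) : ℕ := (Nat.digits b a).length

/-- Value of the finite continued fraction `[0; a₁, a₂, …, aₙ]`. -/
noncomputable def cfVal : List ℕ → ℝ
  | [] => 0
  | (h :: t) => 1 / ((h : ℝ) + cfVal t)

/-- `a` witnesses that `x` is a Trott number in base `b`: the `a i` (indexed from 0)
are positive, `x` is the value of the infinite continued fraction `[0; a 0, a 1, …]`,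
and the base-`b` expansion of `x` is the concatenation of the base-`b` digit strings
of the partial quotients. -/
def IsTrottWith (b : ℕ) (x : ℝ) (a : ℕ → ℕ) : Prop :=
  (∀ i, 0 < a i) ∧
  Tendsto (fun n => cfVal ((List.range n).map a)) atTop (𝓝 x) ∧
  x = ∑' i : ℕ, (a i : ℝ) / (b : ℝ) ^ (∑ j ∈ Finset.range (i + 1), digLen b (a j))

/-- `x` is a Trott number in base `b`. -/
def IsTrott (b : ℕ) (x : ℝ) : Prop := ∃ a, IsTrottWith b x a

/-- The set of Trott numbers in base `b`. -/
def TrottSet (b : ℕ) : Set ℝ := {x | IsTrott b x}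

/-- The value of the concatenation of the base-`b` digit strings of the `a i`. -/
noncomputable def concatVal (b : ℕ) (a : ℕ → ℕ) : ℝ :=
  ∑' i : ℕ, (a i : ℝ) / (b : ℝ) ^ (∑ j ∈ Finset.range (i + 1), digLen b (a j))

/-- `x` is the value of the infinite continued fraction `[0; a 0, a 1, …]`. -/
def IsCFLimit (x : ℝ) (a : ℕ → ℕ) : Prop :=
  (∀ i, 0 < a i) ∧ Tendsto (fun n => cfVal ((List.range n).map a)) atTop (𝓝 x)

/-! ### Digit lengths -/

theorem lt_pow_digLen {b : ℕ} (hb : 2 ≤ b) (n : ℕ) : n < b ^ digLen b n :=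
  Nat.lt_base_pow_length_digits (by omega)

theorem pow_digLen_le {b n : ℕ} (hb : 2 ≤ b) (hn : 0 < n) : b ^ digLen b n ≤ b * n := by
  obtain ⟨k, rfl⟩ : ∃ k, b = k + 2 := ⟨b - 2, by omega⟩
  exact Nat.base_pow_length_digits_le' k n hn.ne'

theorem digLen_pos {b n : ℕ} (hb : 2 ≤ b) (hn : 0 < n) : 0 < digLen b n := by
  by_contra h
  have := lt_pow_digLen hb n
  rw [Nat.eq_zero_of_not_pos h, pow_zero] at this
  omega

theorem digLen_le_of_base_le {b c n : ℕ} (hb : 2 ≤ b) (hbc : b ≤ c) (hn : 0 < n) :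
    digLen c n ≤ digLen b n := by
  by_contra! h
  obtain ⟨k, hk⟩ : ∃ k, digLen c n = k + 1 := ⟨digLen c n - 1, by omega⟩
  have h1 := pow_digLen_le (hb.trans hbc) hn
  rw [hk, pow_succ'] at h1
  have h2 : c ^ k ≤ n := Nat.le_of_mul_le_mul_left h1 (by omega)
  have h3 := lt_pow_digLen hb n
  have h4 : b ^ digLen b n ≤ c ^ digLen b n := Nat.pow_le_pow_left hbc _
  have h5 : c ^ digLen b n ≤ c ^ k := Nat.pow_le_pow_right (by omega) (by omega)
  omega

/-! ### Concatenated expansions -/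

section Concat

variable {b : ℕ} {a : ℕ → ℕ}

theorem concat_partial_sum_le (hb : 2 ≤ b) (n : ℕ) :
    ∑ i ∈ Finset.range n, (a i : ℝ) / (b : ℝ) ^ (∑ j ∈ Finset.range (i + 1), digLen b (a j))
      ≤ 1 - 1 / (b : ℝ) ^ (∑ j ∈ Finset.range n, digLen b (a j)) := by
  have hb0 : (0 : ℝ) < b := by positivity
  induction n with
  | zero => simp
  | succ n ih =>
    rw [Finset.sum_range_succ]
    have h : (a n : ℝ) + 1 ≤ (b : ℝ) ^ digLen b (a n) := by
      exact_mod_cast lt_pow_digLen hb (a n)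
    have key : (a n : ℝ) / (b : ℝ) ^ (∑ j ∈ Finset.range (n + 1), digLen b (a j)) +
        1 / (b : ℝ) ^ (∑ j ∈ Finset.range (n + 1), digLen b (a j))
        ≤ 1 / (b : ℝ) ^ (∑ j ∈ Finset.range n, digLen b (a j)) := by
      rw [← add_div, Finset.sum_range_succ, pow_add, div_le_div_iff₀ (by positivity) (by positivity)]
      have : (0 : ℝ) < (b : ℝ) ^ (∑ j ∈ Finset.range n, digLen b (a j)) := by positivity
      nlinarith
    linarith

theorem concat_summable (hb : 2 ≤ b) :
    Summable fun i : ℕ =>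
      (a i : ℝ) / (b : ℝ) ^ (∑ j ∈ Finset.range (i + 1), digLen b (a j)) := by
  refine summable_of_sum_range_le (c := 1) (fun i => by positivity) fun n => ?_
  have h : (0 : ℝ) ≤ 1 / (b : ℝ) ^ (∑ j ∈ Finset.range n, digLen b (a j)) := by positivity
  linarith [concat_partial_sum_le (a := a) hb n]

theorem concatVal_le_one (hb : 2 ≤ b) : concatVal b a ≤ 1 := by
  refine Real.tsum_le_of_sum_range_le (fun i => by positivity) fun n => ?_
  have h : (0 : ℝ) ≤ 1 / (b : ℝ) ^ (∑ j ∈ Finset.range n, digLen b (a j)) := by positivity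
  linarith [concat_partial_sum_le (a := a) hb n]

theorem concatVal_pos (hb : 2 ≤ b) (ha : ∀ i, 0 < a i) : 0 < concatVal b a := by
  refine (concat_summable hb).tsum_pos (fun i => by positivity) 0 ?_
  have := ha 0
  positivity

theorem pow_mul_concatVal (hb : 2 ≤ b) :
    (b : ℝ) ^ digLen b (a 0) * concatVal b a = a 0 + concatVal b fun i => a (i + 1) := by
  have hb0 : (b : ℝ) ≠ 0 := by positivity
  unfold concatVal
  rw [(concat_summable hb).tsum_eq_zero_add, mul_add, ← tsum_mul_left]
  congr 1
  · simp [field]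
  · refine tsum_congr fun i => ?_
    rw [Finset.sum_range_succ' _ (i + 1), pow_add]
    field_simp

end Concat

/-! ### Continued fractions -/

theorem cfVal_mem_Icc {l : List ℕ} (hl : ∀ k ∈ l, 0 < k) : cfVal l ∈ Set.Icc (0 : ℝ) 1 := by
  induction l with
  | nil => simp [cfVal]
  | cons h t ih =>
    have h1 : (1 : ℝ) ≤ h := by exact_mod_cast hl h (by simp)
    have h2 := (ih fun k hk => hl k (by simp [hk])).1
    simp only [cfVal]
    exact ⟨by positivity, (div_le_one (by positivity)).2 (by linarith)⟩

theorem cfVal_range_succ (a : ℕ → ℕ) (n : ℕ) :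
    cfVal ((List.range (n + 1)).map a) =
      1 / ((a 0 : ℝ) + cfVal ((List.range n).map fun i => a (i + 1))) := by
  rw [List.range_succ_eq_map, List.map_cons, List.map_map]
  rfl

namespace IsCFLimit

variable {x : ℝ} {a : ℕ → ℕ}

theorem pos (h : IsCFLimit x a) : 0 < x := by
  have h0 : (0 : ℝ) < a 0 := by exact_mod_cast h.1 0
  refine lt_of_lt_of_le (show (0 : ℝ) < 1 / (a 0 + 1) by positivity)
    (ge_of_tendsto' ((tendsto_add_atTop_iff_nat 1).2 h.2) fun n => ?_)
  rw [cfVal_range_succ]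
  have := cfVal_mem_Icc (l := (List.range n).map fun i => a (i + 1)) (by simp [h.1])
  exact one_div_le_one_div_of_le (by linarith [this.1]) (by linarith [this.2])

theorem tail (h : IsCFLimit x a) : IsCFLimit (1 / x - a 0) fun i => a (i + 1) := by
  refine ⟨fun i => h.1 _, ?_⟩
  have h1 := (((tendsto_add_atTop_iff_nat 1).2 h.2).inv₀ h.pos.ne').sub_const (a 0 : ℝ)
  rw [one_div]
  refine h1.congr fun n => ?_
  rw [cfVal_range_succ]
  simp

theorem lt_one (h : IsCFLimit x a) : x < 1 := by
  have h0 : (1 : ℝ) ≤ a 0 := by exact_mod_cast h.1 0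
  have h1 := h.tail.pos
  have h2 : 1 < 1 / x := by linarith
  exact (one_lt_div h.pos).1 h2

theorem floor_inv (h : IsCFLimit x a) : ⌊1 / x⌋₊ = a 0 := by
  rw [Nat.floor_eq_iff (by have := h.pos; positivity)]
  constructor <;> linarith [h.tail.pos, h.tail.lt_one]

theorem head_unique {a' : ℕ → ℕ} (h : IsCFLimit x a) (h' : IsCFLimit x a') : a 0 = a' 0 := by
  rw [← h.floor_inv, h'.floor_inv]

end IsCFLimit

theorem IsTrottWith.isCFLimit {b : ℕ} {x : ℝ} {a : ℕ → ℕ} (h : IsTrottWith b x a) :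
    IsCFLimit x a := ⟨h.1, h.2.1⟩

/-- The leading partial quotient of a Trott number has a single digit. -/
theorem IsTrottWith.digLen_head {b : ℕ} {x : ℝ} {a : ℕ → ℕ} (hb : 2 ≤ b)
    (h : IsTrottWith b x a) : digLen b (a 0) = 1 := by
  have hx := h.isCFLimit.pos
  have hz := h.isCFLimit.tail.pos
  have hy := concatVal_pos (a := fun i => a (i + 1)) hb fun i => h.1 _
  have hs := pow_mul_concatVal (a := a) hb
  rw [show concatVal b a = x from h.2.2.symm] at hs
  have ha : (0 : ℝ) < a 0 := by exact_mod_cast h.1 0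
  have h1 : (a 0 : ℝ) * a 0 < (b : ℝ) ^ digLen b (a 0) := by
    have e : (b : ℝ) ^ digLen b (a 0) = (a 0 + concatVal b fun i => a (i + 1)) * (1 / x) := by
      rw [← hs]; field_simp
    rw [e]
    exact mul_lt_mul'' (by linarith) (by linarith) ha.le ha.le
  have h2 : a 0 * a 0 < b ^ digLen b (a 0) := by exact_mod_cast h1
  have h3 := pow_digLen_le hb (h.1 0)
  have h4 := digLen_pos hb (h.1 0)
  by_contra h5
  obtain ⟨k, hk⟩ : ∃ k, digLen b (a 0) = k + 2 := ⟨digLen b (a 0) - 2, by omega⟩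
  rw [hk] at h2 h3
  have h6 : b ^ (k + 1) ≤ a 0 :=
    Nat.le_of_mul_le_mul_left (by rw [← pow_succ']; exact h3) (by omega : 0 < b)
  have h7 : b ^ (k + 2) ≤ b ^ (k + 1) * b ^ (k + 1) := by
    rw [← pow_add]; exact Nat.pow_le_pow_right (by omega) (by omega)
  nlinarith [Nat.mul_le_mul h6 h6]

/-- The tails `y`, `u` of the base-`b` expansion of a Trott number after the digits of its first
and second partial quotients. -/
theorem IsTrottWith.two_step {b : ℕ} {x : ℝ} {a : ℕ → ℕ} (hb : 2 ≤ b) (h : IsTrottWith b x a) :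
    ∃ y u : ℝ, (a 0 + (1 / x - a 0)) * (a 0 + y) = b ∧ 0 < y ∧ y ≤ 1 ∧
      (b : ℝ) ^ digLen b (a 1) * y = a 1 + u ∧ 0 ≤ u ∧ u ≤ 1 := by
  have hx := h.isCFLimit.pos
  have hs := pow_mul_concatVal (a := a) hb
  rw [show concatVal b a = x from h.2.2.symm, h.digLen_head hb, pow_one] at hs
  refine ⟨concatVal b fun i => a (i + 1), concatVal b fun i => a (i + 1 + 1), ?_,
    concatVal_pos hb fun i => h.1 _, concatVal_le_one hb,
    pow_mul_concatVal (a := fun i => a (i + 1)) hb,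
    (concatVal_pos hb fun i => h.1 _).le, concatVal_le_one hb⟩
  rw [← hs]
  field_simp
  ring

/-! ### The arithmetic obstruction -/

/-- If `b` and `c` have a common factor and `m ≤ l`, then `B * b ^ l` and `C * c ^ m` cannot be too
close without being equal, and they can be equal only for small `m`. -/
theorem two_pow_le_of_gcd {b c B C l m : ℕ} (hgcd : 1 < Nat.gcd b c) (hb : 0 < b)
    (hbc : ¬ b ∣ c) (hC : 0 < C) (hml : m ≤ l) :
    2 ^ m ≤ C ∨ (2 ^ m : ℤ) ≤ |(B : ℤ) * b ^ l - C * c ^ m| := by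
  obtain ⟨b', c', hcop, hb', hc'⟩ := Nat.exists_coprime b c
  set d := Nat.gcd b c with hd
  by_cases hN : (B : ℤ) * b ^ l - C * c ^ m = 0
  · left
    have hb2 : 2 ≤ b' := by
      by_contra! hlt
      interval_cases b'
      · exact hb.ne' (by rw [hb', zero_mul])
      · rw [one_mul] at hb'
        exact hbc (hb' ▸ Nat.gcd_dvd_right b c)
    have e : B * b ^ l = C * c ^ m := by exact_mod_cast sub_eq_zero.1 hN
    have h1 : b ^ m ∣ C * c ^ m := e ▸ (pow_dvd_pow b hml).mul_left B
    have h2 : b' ^ m * d ^ m ∣ C * c' ^ m * d ^ m := by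
      rw [← mul_pow, mul_assoc, ← mul_pow, ← hb', ← hc']; exact h1
    have h3 : b' ^ m ∣ C * c' ^ m := Nat.dvd_of_mul_dvd_mul_right (by positivity) h2
    have h4 : b' ^ m ∣ C := (hcop.pow m m).dvd_of_dvd_mul_right h3
    exact (Nat.pow_le_pow_left hb2 m).trans (Nat.le_of_dvd hC h4)
  · right
    have hdb : (d : ℤ) ∣ b := by exact_mod_cast Nat.gcd_dvd_left b c
    have hdc : (d : ℤ) ∣ c := by exact_mod_cast Nat.gcd_dvd_right b c
    have h1 : (d : ℤ) ^ m ∣ (B : ℤ) * b ^ l - C * c ^ m :=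
      dvd_sub (((pow_dvd_pow_of_dvd hdb m).trans (pow_dvd_pow _ hml)).mul_left _)
        ((pow_dvd_pow_of_dvd hdc m).mul_left _)
    have h2 : (d : ℤ) ^ m ≤ |(B : ℤ) * b ^ l - C * c ^ m| :=
      Int.le_of_dvd (abs_pos.2 hN) ((dvd_abs _ _).2 h1)
    have h3 : (2 : ℤ) ^ m ≤ (d : ℤ) ^ m :=
      pow_le_pow_left₀ (by norm_num) (by exact_mod_cast hgcd) m
    exact h3.trans h2

/-- A ratio `q` close to `1` has `q ^ m` much smaller than `2 ^ m`. -/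
theorem false_of_growth {a q : ℝ} {m : ℕ} (ha : 3 ≤ a) (hq0 : 0 ≤ q) (hq : q ≤ 6 / 5)
    (hlow : 24 / 25 * a ≤ q ^ m) (hup : (2 : ℝ) ^ m ≤ 5 / 2 * a ^ 2) : False := by
  have h1 : (24 / 25 * a) ^ 3 ≤ (q ^ m) ^ 3 := by gcongr
  have h2 : (q ^ m) ^ 3 ≤ 2 ^ m := by
    rw [← pow_mul, mul_comm, pow_mul]
    refine pow_le_pow_left₀ (by positivity) ?_ m
    calc q ^ 3 ≤ (6 / 5) ^ 3 := by gcongr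
      _ ≤ 2 := by norm_num
  nlinarith [sq_nonneg a]

/-- Estimates for a single base, with `P` the power of the base that shifts out the digits of `A`:
`B * P` is only slightly larger than `a * A`. -/
theorem defect_bounds {a A P y z u B : ℝ} (ha : 3 ≤ a) (hA : 100 ≤ A) (hy : 24 / 25 ≤ a * y)
    (hy1 : y ≤ 1) (hz0 : 0 < z) (hzA : z * A < 1) (hP0 : 0 ≤ P) (hP : P * y = A + u)
    (hu0 : 0 ≤ u) (hu1 : u ≤ 1) (hB : B = a * y + (a + y) * z) :
    0 ≤ B * P - a * A ∧ B * P - a * A ≤ 5 / 2 * a ^ 2 := by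
  have hy0 : 0 < y := by by_contra! h; nlinarith
  have e : B * P - a * A = a * u + (a + y) * (P * z) := by
    rw [hB]; linear_combination a * hP
  have hPz : P * z ≤ 110 / 100 * a := by
    have h1 : (P * y) * z ≤ 101 / 100 := by
      rw [hP]; nlinarith
    have h2 : P * z * (24 / 25) ≤ P * z * (a * y) :=
      mul_le_mul_of_nonneg_left hy (by positivity)
    nlinarith
  have hPz0 : 0 ≤ P * z := by positivity
  rw [e]
  constructor
  · positivity
  · have h3 : (a + y) * (P * z) ≤ (a + 1) * (110 / 100 * a) := by gcongr
    nlinarith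

/-- The conditions on the first two partial quotients `a`, `A` of a common Trott number in bases
`b` and `c` are contradictory. -/
theorem arithmetic_obstruction {a b c A l m : ℕ} {y y' z u u' : ℝ} (ha : 0 < a) (hA : 0 < A)
    (hbc : b < c) (hgcd : 1 < Nat.gcd b c) (hb : (a + z) * (a + y) = b)
    (hc : (a + z) * (a + y') = c) (hy0 : 0 < y) (hy'1 : y' ≤ 1)
    (hz0 : 0 < z) (hzA : z * A < 1) (hP : (b : ℝ) ^ l * y = A + u) (hu0 : 0 ≤ u) (hu1 : u ≤ 1)
    (hP' : (c : ℝ) ^ m * y' = A + u') (hu'0 : 0 ≤ u') (hu'1 : u' ≤ 1)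
    (hm : 0 < m) (hml : m ≤ l) (hAb : b ^ l ≤ b * A) (hAc : A < c ^ m) : False := by
  have haR : (1 : ℝ) ≤ a := by exact_mod_cast ha
  have hAR : (1 : ℝ) ≤ A := by exact_mod_cast hA
  have hz1 : z < 1 := by nlinarith only [hzA, hAR, hz0]
  have hbaR : (a : ℝ) ^ 2 < b := by rw [← hb]; nlinarith only [haR, hz0, hy0]
  have hba : a ^ 2 < b := by exact_mod_cast hbaR
  have hb0 : (0 : ℝ) < b := (sq_nonneg _).trans_lt hbaR
  have hbcR : (b : ℝ) + 1 ≤ c := by exact_mod_cast hbc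
  have hc0 : (0 : ℝ) < c := by linarith
  have hdiff : (c : ℝ) - b = (a + z) * (y' - y) := by rw [← hb, ← hc]; ring
  have hyy' : y < y' := by by_contra! h; nlinarith only [h, hdiff, hbcR, hz0, haR]
  have hy'0 : 0 < y' := hy0.trans hyy'
  have hgap : b + 2 ≤ c := by
    have h1 : Nat.gcd b c ∣ c - b := Nat.dvd_sub (Nat.gcd_dvd_right b c) (Nat.gcd_dvd_left b c)
    have h2 := Nat.le_of_dvd (by omega) h1
    omega
  -- the second partial quotient has strictly more digits in base `b`
  have hlt : m < l := by
    rcases hml.lt_or_eq with h | rfl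
    · exact h
    exfalso
    have h1 : (b : ℝ) ^ m ≤ (c : ℝ) ^ m := by gcongr
    have h2 : (c : ℝ) ≤ (c : ℝ) ^ m := le_self_pow₀ (by linarith) hm.ne'
    have h3 : (c : ℝ) ^ m * (y' - y) ≤ 1 := by nlinarith only [h1, hP, hP', hu0, hu'1, hy0]
    have h4 : (c : ℝ) * (y' - y) ≤ 1 := by nlinarith only [h2, h3, hyy']
    have h5 : (a : ℝ) + z < c := by nlinarith only [hbcR, hbaR, haR, hz1]
    linarith [mul_lt_mul_of_pos_right h5 (sub_pos.2 hyy')]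
  have hbA : b ^ m ≤ A := by
    obtain ⟨k, rfl⟩ : ∃ k, l = k + 1 := ⟨l - 1, by omega⟩
    rw [pow_succ'] at hAb
    exact (Nat.pow_le_pow_right (by omega) (by omega)).trans
      (Nat.le_of_mul_le_mul_left hAb (by omega))
  have hbA1 : b ≤ A := (Nat.le_self_pow hm.ne' b).trans hbA
  have hbAR : (b : ℝ) ≤ A := by exact_mod_cast hbA1
  have hzb : z * b < 1 := (mul_le_mul_of_nonneg_left hbAR hz0.le).trans_lt hzA
  obtain ⟨B, hbB⟩ : ∃ B, b = a ^ 2 + B := ⟨b - a ^ 2, by omega⟩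
  obtain ⟨C, hcC⟩ : ∃ C, c = a ^ 2 + C := ⟨c - a ^ 2, by omega⟩
  have hbBR : (b : ℝ) = a ^ 2 + B := by exact_mod_cast hbB
  have hcCR : (c : ℝ) = a ^ 2 + C := by exact_mod_cast hcC
  have hB : (B : ℝ) = a * y + (a + y) * z := by linear_combination -hb - hbBR
  have hC : (C : ℝ) = a * y' + (a + y') * z := by linear_combination -hc - hcCR
  have hB1 : 1 ≤ B := by omega
  have hB1R : (1 : ℝ) ≤ B := by exact_mod_cast hB1
  have hgapR : (b : ℝ) + 2 ≤ c := by exact_mod_cast hgap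
  have ha2 : 2 ≤ a := by
    by_contra! h
    have ha1 : (a : ℝ) = 1 := by exact_mod_cast (by omega : a = 1)
    rw [ha1] at hdiff
    nlinarith only [hdiff, hgapR, hz0, hz1, hy0, hy'1, hyy']
  have hab : a + 1 ≤ b := by nlinarith only [ha2, hba]
  have habR : (a : ℝ) + 1 ≤ b := by exact_mod_cast hab
  have hazlt : ((a : ℝ) + 1) * z < 1 := by
    linarith [mul_le_mul_of_nonneg_left habR hz0.le]
  have hCa : C ≤ a := by
    have : (C : ℝ) < a + 1 := by rw [hC]; nlinarith only [hazlt, hy'1, hz0, haR]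
    have : C < a + 1 := by exact_mod_cast this
    omega
  have ha3 : 3 ≤ a := by omega
  have ha3R : (3 : ℝ) ≤ a := by exact_mod_cast ha3
  have haa : 3 * a ≤ a ^ 2 := by nlinarith only [ha3]
  have haaR : (3 : ℝ) * a ≤ a ^ 2 := by exact_mod_cast haa
  have hb10R : (10 : ℝ) ≤ b := by linarith
  -- the two bases are close
  have hq : (c : ℝ) / b ≤ 6 / 5 := by
    rw [div_le_iff₀ hb0]
    have h1 : (c : ℝ) ≤ b + a - 1 := by
      have : c + 1 ≤ b + a := by omega
      have : (c : ℝ) + 1 ≤ b + a := by exact_mod_cast this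
      linarith
    nlinarith only [h1, hbBR, hB1R, ha3R]
  have hlow : b * y ≤ ((c : ℝ) / b) ^ m := by
    rw [div_pow, le_div_iff₀ (by positivity)]
    have h1 : (b : ℝ) ^ (m + 1) ≤ (b : ℝ) ^ l := pow_le_pow_right₀ (by linarith) hlt
    have h2 : (A : ℝ) + 1 ≤ (c : ℝ) ^ m := by exact_mod_cast hAc
    calc b * y * (b : ℝ) ^ m = (b : ℝ) ^ (m + 1) * y := by ring
      _ ≤ (b : ℝ) ^ l * y := by gcongr
      _ ≤ (c : ℝ) ^ m := by linarith
  have hay : 1 - (a + 1) * z ≤ a * y := by nlinarith only [hB, hB1R, hz0, hyy', hy'1]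
  have hm2 : 2 ≤ m := by
    by_contra! h
    obtain rfl : m = 1 := by omega
    rw [pow_one] at hlow
    have h1 : (b : ℝ) * (a * y) ≤ 6 / 5 * a := by nlinarith only [hlow, hq, haR]
    have h2 : (b : ℝ) * (1 - (a + 1) * z) ≤ b * (a * y) := by gcongr
    nlinarith only [h1, h2, hzb, haR, ha3R, haaR, hbaR]
  have hb2A : b ^ 2 ≤ A := (Nat.pow_le_pow_right (by omega) hm2).trans hbA
  have hb2AR : (b : ℝ) ^ 2 ≤ A := by exact_mod_cast hb2A
  have hA100 : (100 : ℝ) ≤ A := by nlinarith only [hb2AR, hb10R]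
  have hay' : 24 / 25 ≤ a * y := by
    have h1 : z * (b : ℝ) ^ 2 ≤ 1 := by
      linarith [mul_le_mul_of_nonneg_left hb2AR hz0.le]
    have h2 : (a + 1) * z ≤ 1 / 25 := by
      have h3 : ((a : ℝ) + 1) * 25 ≤ b ^ 2 := by
        nlinarith only [haaR, hbBR, hB1R, ha3R, hb10R]
      linarith [mul_le_mul_of_nonneg_left h3 hz0.le]
    linarith
  have hD := defect_bounds ha3R hA100 hay' (hyy'.le.trans hy'1) hz0 hzA (by positivity) hP hu0 hu1
    hB
  have hD' := defect_bounds ha3R hA100 (hay'.trans (by gcongr)) hy'1 hz0 hzA (by positivity) hP'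
    hu'0 hu'1 hC
  have hup : (2 : ℝ) ^ m ≤ 5 / 2 * (a : ℝ) ^ 2 := by
    have hndvd : ¬ b ∣ c := by
      intro h
      have h1 : b ∣ c - b := Nat.dvd_sub h dvd_rfl
      have h2 := Nat.le_of_dvd (by omega) h1
      omega
    rcases two_pow_le_of_gcd (B := B) (C := C) hgcd (by omega) hndvd (by omega) hml with h | h
    · have h1 : (2 : ℝ) ^ m ≤ a := by exact_mod_cast h.trans hCa
      linarith
    · have h1 : (2 : ℝ) ^ m ≤ |(B : ℝ) * b ^ l - C * c ^ m| := by exact_mod_cast h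
      refine h1.trans (abs_le.2 ⟨?_, ?_⟩) <;> linarith [hD.1, hD.2, hD'.1, hD'.2]
  refine false_of_growth ha3R (by positivity) hq (le_trans ?_ hlow) hup
  nlinarith only [hay', hbaR, haR, hy0]

/-- If `2 ≤ b < c` and `gcd(b,c) > 1`, then no number is Trott in both base `b`
and base `c`. -/
theorem trott_not_common_factor (b c : ℕ) (hb : 2 ≤ b) (hbc : b < c)
    (hgcd : 1 < Nat.gcd b c) :
    TrottSet b ∩ TrottSet c = ∅ := by
  refine Set.eq_empty_iff_forall_notMem.2 ?_
  rintro x ⟨⟨a, ha⟩, ⟨a', ha'⟩⟩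
  have h0 : a' 0 = a 0 := ha'.isCFLimit.head_unique ha.isCFLimit
  have htail := ha'.isCFLimit.tail
  rw [h0] at htail
  have h1 : a' 1 = a 1 := htail.head_unique ha.isCFLimit.tail
  obtain ⟨y, u, hby, hy0, hy1, hP, hu0, hu1⟩ := ha.two_step hb
  obtain ⟨y', u', hcy, hy'0, hy'1, hP', hu'0, hu'1⟩ := ha'.two_step (hb.trans hbc.le)
  rw [h0] at hcy
  rw [h1] at hP'
  have hA := ha.1 1
  have hz := ha.isCFLimit.tail.pos
  have hzA : (1 / x - a 0) * a 1 < 1 := by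
    have h2 := ha.isCFLimit.tail.tail.pos
    have h3 : (a 1 : ℝ) < 1 / (1 / x - a 0) := by simpa using h2
    rw [lt_div_iff₀ hz] at h3
    linarith
  exact arithmetic_obstruction (ha.1 0) hA hbc hgcd hby hcy hy0 hy'1 hz hzA hP hu0 hu1 hP' hu'0
    hu'1 (digLen_pos (hb.trans hbc.le) hA) (digLen_le_of_base_le hb hbc.le hA)
    (pow_digLen_le hb hA) (lt_pow_digLen (hb.trans hbc.le) _)
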